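/- arXiv:0712.3217 — 6 statements merged into one kernel-verified Lean document; each statement's English description precedes it below -/
import Mathlib

section
/- In the one-dimensional upwind setup, for any starting index i ∈ ℤ and any bounded measurable u⁰ : ℝ → ℝ, the numerical solution satisfies, for every n ≥ 0, u^n_i = E_i[u⁰_{I_n}], where u⁰_j = (Δx_j)^{-1} ∫_{K_j} u⁰(x) dx. -/
open MeasureTheory

lemma step_aux {Ω : Type*} [MeasurableSpace Ω] (P : Measure Ω) [IsProbabilityMeasure P]
    (X Y : Ω → ℤ) (hY : Measurable Y)
    (p : ℤ → ℤ → ℝ) (hp : ∀ i j, 0 ≤ p i j)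
    (hint : ∀ j, Integrable (fun ω => p (X ω) j) P)
    (hlaw : ∀ j, ∫ ω, p (X ω) j ∂P = P.real {ω | Y ω = j})
    (f : ℤ → ℝ) (M : ℝ) (hf : ∀ j, |f j| ≤ M) :
    ∫ ω, f (Y ω) ∂P = ∫ ω, ∑' j, p (X ω) j * f j ∂P := by
  have hpm : IsProbabilityMeasure (P.map Y) := Measure.isProbabilityMeasure_map hY.aemeasurable
  have hfi : Integrable f (P.map Y) :=
    Integrable.of_bound (measurable_of_countable f).aestronglyMeasurable M
      (Filter.Eventually.of_forall hf)
  have hm : ∀ j, (P.map Y).real {j} = P.real {ω | Y ω = j} := by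
    intro j
    rw [map_measureReal_apply hY (measurableSet_singleton j)]
    rfl
  have hs : Summable (fun j => P.real {ω | Y ω = j} * |f j|) := by
    have h1 := (hasSum_integral_iUnion (μ := P.map Y) (f := fun j => |f j|)
      (s := fun j : ℤ => {j}) (fun j => measurableSet_singleton j)
      (fun a b hab => by simpa using hab) hfi.abs.integrableOn).summable
    refine h1.congr fun j => ?_
    rw [← hm j]
    simp [Measure.real]
  rw [← integral_map hY.aemeasurable (measurable_of_countable f).aestronglyMeasurable,
    integral_countable hfi, ← integral_tsum_of_summable_integral_norm]
  · refine tsum_congr fun j => ?_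
    rw [integral_mul_const, hlaw, hm, smul_eq_mul]
  · intro j
    exact (hint j).mul_const _
  · refine hs.congr fun j => ?_
    have : ∀ ω, ‖p (X ω) j * f j‖ = p (X ω) j * |f j| := fun ω => by
      rw [norm_mul, Real.norm_of_nonneg (hp _ _), Real.norm_eq_abs]
    simp_rw [this]
    rw [integral_mul_const, hlaw]

/-- **Backward Kolmogorov formula for the one-dimensional upwind scheme.**
In the one-dimensional upwind setup (bounded `κ`-Lipschitz velocity `a`, strictly
increasing mesh `x : ℤ → ℝ` tending to `±∞`, cell sizes bounded by `h`, time step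
`Δt > 0`, upwind transition weights `p` satisfying the CFL condition), for any
starting index `i` and bounded measurable `u0 : ℝ → ℝ`, the upwind numerical
solution satisfies `u n i = E_i [u⁰_{I n}]` where `u⁰_j` is the mean of `u0` on
the cell `K_j = [x j, x (j+1)]`. -/
theorem stmt_1
    (a : ℝ → ℝ) (κ Ca : ℝ)
    (ha_bdd : ∀ y, |a y| ≤ Ca)
    (ha_lip : ∀ y z, |a y - a z| ≤ κ * |y - z|)
    (x : ℤ → ℝ) (hx_mono : StrictMono x)
    (hx_top : Filter.Tendsto x Filter.atTop Filter.atTop)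
    (hx_bot : Filter.Tendsto x Filter.atBot Filter.atBot)
    (h Δt : ℝ) (hh : ∀ i : ℤ, x (i + 1) - x i ≤ h) (hΔt : 0 < Δt)
    (p : ℤ → ℤ → ℝ)
    (hp_left : ∀ i : ℤ, p i (i - 1) = max (a (x i)) 0 * Δt / (x (i + 1) - x i))
    (hp_right : ∀ i : ℤ, p i (i + 1) = max (-a (x (i + 1))) 0 * Δt / (x (i + 1) - x i))
    (hp_diag : ∀ i : ℤ, p i i = 1 - p i (i - 1) - p i (i + 1))
    (hp_zero : ∀ i j : ℤ, j ≠ i - 1 → j ≠ i → j ≠ i + 1 → p i j = 0)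
    (hCFL : ∀ i : ℤ, p i (i - 1) + p i (i + 1) ≤ 1)
    (u0 : ℝ → ℝ) (M : ℝ) (hu0_bdd : ∀ y, |u0 y| ≤ M) (hu0_meas : Measurable u0)
    (u : ℕ → ℤ → ℝ)
    (hu_init : ∀ i : ℤ, u 0 i = (x (i + 1) - x i)⁻¹ * ∫ y in Set.Icc (x i) (x (i + 1)), u0 y)
    (hu_rec : ∀ (n : ℕ) (i : ℤ), u (n + 1) i = ∑' j, p i j * u n j)
    {Ω : Type*} [MeasurableSpace Ω] (P : Measure Ω) [IsProbabilityMeasure P]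
    (I : ℕ → Ω → ℤ) (hI_meas : ∀ n, Measurable (I n))
    (i : ℤ) (hstart : ∀ᵐ ω ∂P, I 0 ω = i)
    (hMarkov : ∀ (n : ℕ) (j : ℤ),
      P[(Set.indicator {ω | I (n + 1) ω = j} fun _ => (1 : ℝ)) |
          ⨆ k ∈ Set.Iic n, MeasurableSpace.comap (I k) inferInstance]
        =ᵐ[P] fun ω => p (I n ω) j)
    (n : ℕ) :
    u n i = ∫ ω, ((x (I n ω + 1) - x (I n ω))⁻¹ *
        ∫ y in Set.Icc (x (I n ω)) (x (I n ω + 1)), u0 y) ∂P := by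
  have hd : ∀ k : ℤ, 0 < x (k + 1) - x k := fun k => sub_pos.2 (hx_mono (by omega))
  have hpl : ∀ k, 0 ≤ p k (k - 1) := fun k => by
    rw [hp_left]; have := hd k; positivity
  have hpr : ∀ k, 0 ≤ p k (k + 1) := fun k => by
    rw [hp_right]; have := hd k; positivity
  have hpd : ∀ k, 0 ≤ p k k := fun k => by
    rw [hp_diag]; linarith [hCFL k]
  have hp : ∀ k j, 0 ≤ p k j := by
    intro k j
    by_cases h1 : j = k - 1
    · rw [h1]; exact hpl k
    by_cases h2 : j = k
    · rw [h2]; exact hpd k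
    by_cases h3 : j = k + 1
    · rw [h3]; exact hpr k
    rw [hp_zero k j h1 h2 h3]
  have hsum : ∀ (k : ℤ) (f : ℤ → ℝ), ∑' j, p k j * f j =
      p k (k - 1) * f (k - 1) + (p k k * f k + p k (k + 1) * f (k + 1)) := by
    intro k f
    rw [tsum_eq_sum (s := {k - 1, k, k + 1})]
    · rw [Finset.sum_insert (by simp; omega), Finset.sum_insert (by simp), Finset.sum_singleton]
    · intro j hj
      simp only [Finset.mem_insert, Finset.mem_singleton, not_or] at hj
      rw [hp_zero k j hj.1 hj.2.1 hj.2.2, zero_mul]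
  have hub : ∀ m k, |u m k| ≤ M := by
    intro m
    induction m with
    | zero =>
      intro k
      have hb := norm_setIntegral_le_of_norm_le_const (μ := volume)
        (s := Set.Icc (x k) (x (k + 1))) (f := u0) (C := M) (by simp) (fun y _ => hu0_bdd y)
      rw [Real.volume_real_Icc_of_le (by linarith [hd k]), Real.norm_eq_abs] at hb
      rw [hu_init, abs_mul, abs_of_pos (inv_pos.2 (hd k)), inv_mul_le_iff₀ (hd k)]
      linarith
    | succ m ih =>
      intro k
      rw [hu_rec, hsum]
      have h1 := abs_le.1 (ih (k - 1))
      have h2 := abs_le.1 (ih k)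
      have h3 := abs_le.1 (ih (k + 1))
      have e : M = p k (k - 1) * M + (p k k * M + p k (k + 1) * M) := by
        rw [hp_diag k]; ring
      have a1 := mul_le_mul_of_nonneg_left h1.1 (hpl k)
      have a2 := mul_le_mul_of_nonneg_left h2.1 (hpd k)
      have a3 := mul_le_mul_of_nonneg_left h3.1 (hpr k)
      have b1 := mul_le_mul_of_nonneg_left h1.2 (hpl k)
      have b2 := mul_le_mul_of_nonneg_left h2.2 (hpd k)
      have b3 := mul_le_mul_of_nonneg_left h3.2 (hpr k)
      rw [abs_le]
      constructor <;> linarith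
  have hstep : ∀ m k, ∫ ω, u m (I (k + 1) ω) ∂P = ∫ ω, u (m + 1) (I k ω) ∂P := by
    intro m k
    simp_rw [hu_rec m]
    have hle : (⨆ l ∈ Set.Iic k, MeasurableSpace.comap (I l) inferInstance) ≤
        (inferInstance : MeasurableSpace Ω) :=
      iSup₂_le fun l _ => (hI_meas l).comap_le
    refine step_aux P (I k) (I (k + 1)) (hI_meas _) p hp ?_ ?_ (u m) M (hub m)
    · intro j
      exact integrable_condExp.congr (hMarkov k j)
    · intro j
      rw [← integral_congr_ae (hMarkov k j), integral_condExp hle]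
      exact integral_indicator_one (hI_meas (k + 1) (measurableSet_singleton j))
  have hall : ∀ k m, ∫ ω, u m (I k ω) ∂P = u (m + k) i := by
    intro k
    induction k with
    | zero =>
      intro m
      have : (fun ω => u m (I 0 ω)) =ᵐ[P] fun _ => u m i := by
        filter_upwards [hstart] with ω hω
        rw [hω]
      rw [integral_congr_ae this]
      simp
    | succ k ih =>
      intro m
      rw [hstep, ih]
      congr 1
      omega
  have := hall n 0
  rw [zero_add] at this
  rw [← this]
  simp_rw [hu_init]
end

section
/- Let S be a countable set, (p_{K,L})_{K,L∈S} a stochastic matrix, μ an invariant probability for p with μ(K) > 0 for all K, and set q_{K,J} = μ(J) p_{J,K} / μ(K). Let d ≥ 1 and suppose given points e_K ∈ ℝ^d for K ∈ S and x_{K,J} ∈ ℝ^d for pairs of distinct K, J ∈ S, such that |e_K − x_{K,J}| ≤ h whenever q_{K,J} > 0, and such that the barycenter condition Σ_{J≠K} q_{K,J} (e_K − x_{K,J}) = 0 holds for every K. Let (K_n)_{n≥0} be a Markov chain with transition matrix p and initial law μ, under a probability measure P_μ with expectation E_μ. For n ≥ 1 define the gap G_n = (e_{K_n} − x_{K_n,K_{n−1}})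 1_{{K_{n−1} ≠ K_n}}. Then for every N ≥ 1 and every 1 ≤ n ≤ N, E_μ[G_n | K_n, K_{n+1}, …, K_N] = 0 almost surely; consequently, the process defined by M⃖_0 = M⃖_1 = 0 and M⃖_n = Σ_{k=N−n+1}^{N−1} G_k for 2 ≤ n ≤ N is a martingale with respect to the backward filtration (σ(K_{N−n},…,K_N))_{0≤n≤N}. -/
open MeasureTheory

theorem aux_condExp_zero {Ω T E : Type*} [NormedAddCommGroup E] [NormedSpace ℝ E] [CompleteSpace E]
    [mΩ : MeasurableSpace Ω] (P : Measure Ω) [IsProbabilityMeasure P] [Countable T] [mT : MeasurableSpace T]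
    [MeasurableSingletonClass T] (Φ : Ω → T) (hΦ : Measurable Φ) (g : Ω → E)
    (hg : Integrable g P) (h0 : ∀ t, ∫ ω in Φ ⁻¹' {t}, g ω ∂P = 0) :
    P[g | MeasurableSpace.comap Φ mT] =ᵐ[P] 0 := by
  symm
  refine ae_eq_condExp_of_forall_setIntegral_eq hΦ.comap_le hg ?_ ?_ ?_
  · intro s _ _
    exact integrableOn_zero
  · rintro s ⟨B, hB, rfl⟩ -
    have : Φ ⁻¹' B = ⋃ t : B, Φ ⁻¹' {t.1} := by
      ext ω; simp
    simp only [Pi.zero_apply, integral_zero]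
    rw [this, integral_iUnion]
    · simp [h0]
    · exact fun t => hΦ (measurableSet_singleton _)
    · intro a b hab
      refine Disjoint.preimage _ ?_
      simpa [Subtype.ext_iff] using fun h => hab (Subtype.ext h)
    · exact hg.integrableOn
  · exact stronglyMeasurable_zero.aestronglyMeasurable

theorem aux_step {S Ω : Type*} [Countable S] [MeasurableSpace S] [MeasurableSingletonClass S]
    [MeasurableSpace Ω] (P : Measure Ω) [IsProbabilityMeasure P] (p : S → S → ℝ)
    (Kc : ℕ → Ω → S) (hKc_meas : ∀ n, Measurable (Kc n))
    (hMarkov : ∀ (n : ℕ) (J : S),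
      P[(Set.indicator {ω | Kc (n + 1) ω = J} fun _ => (1 : ℝ)) |
          ⨆ i ∈ Set.Iic n, MeasurableSpace.comap (Kc i) inferInstance]
        =ᵐ[P] fun ω => p (Kc n ω) J) (n : ℕ) (a b : S) (B : Set Ω)
    (hB : MeasurableSet[⨆ i ∈ Set.Iic n, MeasurableSpace.comap (Kc i) inferInstance] B)
    (hBa : ∀ ω ∈ B, Kc n ω = a) :
    P.real (B ∩ {ω | Kc (n+1) ω = b}) = P.real B * p a b := by
  have hle : (⨆ i ∈ Set.Iic n, MeasurableSpace.comap (Kc i) inferInstance) ≤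
      (inferInstance : MeasurableSpace Ω) :=
    iSup₂_le fun i _ => (hKc_meas i).comap_le
  have hmb : MeasurableSet {ω | Kc (n+1) ω = b} := hKc_meas (n+1) (measurableSet_singleton b)
  have h1 := setIntegral_condExp hle
    (f := Set.indicator {ω | Kc (n + 1) ω = b} fun _ => (1 : ℝ)) (μ := P)
    ((integrable_const (1:ℝ)).indicator hmb) hB
  have h2 : ∫ ω in B, (P[(Set.indicator {ω | Kc (n + 1) ω = b} fun _ => (1 : ℝ)) |
          ⨆ i ∈ Set.Iic n, MeasurableSpace.comap (Kc i) inferInstance]) ω ∂P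
      = ∫ ω in B, p a b ∂P := by
    refine setIntegral_congr_ae (hle _ hB) ?_
    filter_upwards [hMarkov n b] with ω hω hωB
    rw [hω, hBa ω hωB]
  rw [h2, setIntegral_indicator hmb] at h1
  simpa using h1.symm

theorem aux_cyl {S Ω : Type*} [Countable S] [MeasurableSpace S] [MeasurableSingletonClass S]
    [MeasurableSpace Ω] (P : Measure Ω) [IsProbabilityMeasure P] (p : S → S → ℝ)
    (Kc : ℕ → Ω → S) (hKc_meas : ∀ n, Measurable (Kc n))
    (hMarkov : ∀ (n : ℕ) (J : S),
      P[(Set.indicator {ω | Kc (n + 1) ω = J} fun _ => (1 : ℝ)) |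
          ⨆ i ∈ Set.Iic n, MeasurableSpace.comap (Kc i) inferInstance]
        =ᵐ[P] fun ω => p (Kc n ω) J) (n : ℕ) (s : ℕ → S) (B : Set Ω)
    (hB : MeasurableSet[⨆ i ∈ Set.Iic n, MeasurableSpace.comap (Kc i) inferInstance] B) (k : ℕ) :
    MeasurableSet[⨆ i ∈ Set.Iic (n + k), MeasurableSpace.comap (Kc i) inferInstance]
      (B ∩ {ω | ∀ i ≤ k, Kc (n + i) ω = s (n + i)}) ∧
    P.real (B ∩ {ω | ∀ i ≤ k, Kc (n + i) ω = s (n + i)}) =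
      P.real (B ∩ {ω | Kc n ω = s n}) * ∏ i ∈ Finset.range k, p (s (n + i)) (s (n + i + 1)) := by
  have key : ∀ m (c : S), MeasurableSet[⨆ i ∈ Set.Iic m,
      MeasurableSpace.comap (Kc i) inferInstance] {ω | Kc m ω = c} := by
    intro m c
    refine (le_iSup₂_of_le (f := fun i (_ : i ∈ Set.Iic m) =>
      MeasurableSpace.comap (Kc i) inferInstance) m (by simp) le_rfl) _ ?_
    exact ⟨{c}, measurableSet_singleton c, rfl⟩
  induction k with
  | zero =>
    simp only [Nat.le_zero, forall_eq, add_zero, Finset.range_zero, Finset.prod_empty, mul_one,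
      and_true]
    exact MeasurableSet.inter hB (key n _)
  | succ k ih =>
    obtain ⟨ih1, ih2⟩ := ih
    have hset : B ∩ {ω | ∀ i ≤ k + 1, Kc (n + i) ω = s (n + i)} =
        (B ∩ {ω | ∀ i ≤ k, Kc (n + i) ω = s (n + i)}) ∩
          {ω | Kc (n + k + 1) ω = s (n + k + 1)} := by
      ext ω
      simp only [Set.mem_inter_iff, Set.mem_ofPred_eq, and_assoc]
      refine and_congr_right fun _ => ⟨fun h => ⟨fun i hi => h i (by omega), h (k+1) le_rfl⟩, ?_⟩
      rintro ⟨h1, h2⟩ i hi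
      rcases Nat.lt_or_ge i (k+1) with h | h
      · exact h1 i (by omega)
      · obtain rfl : i = k + 1 := by omega
        exact h2
    rw [hset]
    constructor
    · refine MeasurableSet.inter ?_ (key (n + k + 1) _)
      refine (biSup_mono fun i hi => ?_ : (⨆ i ∈ Set.Iic (n + k),
        MeasurableSpace.comap (Kc i) inferInstance) ≤ _) _ ih1
      simp only [Set.mem_Iic] at *
      omega
    · rw [aux_step P p Kc hKc_meas hMarkov (n + k) (s (n + k)) _ _ ih1
        (fun ω hω => hω.2 k le_rfl), ih2, Finset.prod_range_succ, mul_assoc]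

/-- **The gaps of the random characteristic are conditionally centered given the
future; they sum to a backward martingale.**  `p` is a stochastic matrix on a
countable set `S`, `μ` an invariant probability with `μ K > 0`, and
`q K J = μ J * p J K / μ K` the reversed kernel.  Points `e K ∈ ℝ^d` and
`xf K J ∈ ℝ^d` satisfy `‖e K − xf K J‖ ≤ h` whenever `q K J > 0` and the
barycenter condition `∑_{J ≠ K} q K J • (e K − xf K J) = 0`.  `(Kc n)` is a
Markov chain with transitions `p` and initial law `μ`, and for `n ≥ 1` the gap
is `G n = (e (Kc n) − xf (Kc n) (Kc (n−1))) 1_{Kc (n−1) ≠ Kc n}`.  Then, for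
`1 ≤ n ≤ N`, `E[G n | Kc n, …, Kc N] = 0` a.s., and the process
`M⃖ n = ∑_{k=N−n+1}^{N−1} G k` is a martingale for the backward filtration
`σ(Kc (N−n), …, Kc N)` (adapted, integrable, with the martingale property). -/
theorem stmt_7
    {S : Type*} [Countable S] [DecidableEq S] [MeasurableSpace S] [MeasurableSingletonClass S]
    (d : ℕ) (hd : 1 ≤ d) (h : ℝ) (hh : 0 < h)
    (p : S → S → ℝ)
    (hp_nonneg : ∀ K L, 0 ≤ p K L)
    (hp_row : ∀ K, ∑' L, p K L = 1)
    (μ : S → ℝ) (hμ_pos : ∀ K, 0 < μ K) (hμ_sum : ∑' K, μ K = 1)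
    (hμ_inv : ∀ K, μ K = ∑' J, μ J * p J K)
    (e : S → EuclideanSpace ℝ (Fin d)) (xf : S → S → EuclideanSpace ℝ (Fin d))
    (hclose : ∀ K J, K ≠ J → 0 < μ J * p J K / μ K → ‖e K - xf K J‖ ≤ h)
    (hbar : ∀ K, ∑' J, (if J = K then 0 else (μ J * p J K / μ K) • (e K - xf K J)) = 0)
    {Ω : Type*} [MeasurableSpace Ω] (P : Measure Ω) [IsProbabilityMeasure P]
    (Kc : ℕ → Ω → S) (hKc_meas : ∀ n, Measurable (Kc n))
    (hinit : ∀ K : S, (P {ω | Kc 0 ω = K}).toReal = μ K)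
    (hMarkov : ∀ (n : ℕ) (J : S),
      P[(Set.indicator {ω | Kc (n + 1) ω = J} fun _ => (1 : ℝ)) |
          ⨆ i ∈ Set.Iic n, MeasurableSpace.comap (Kc i) inferInstance]
        =ᵐ[P] fun ω => p (Kc n ω) J)
    (G : ℕ → Ω → EuclideanSpace ℝ (Fin d))
    (hG : ∀ n : ℕ, 1 ≤ n → ∀ ω,
      G n ω = if Kc (n - 1) ω = Kc n ω then 0 else e (Kc n ω) - xf (Kc n ω) (Kc (n - 1) ω))
    (N : ℕ) (hN : 1 ≤ N) :
    (∀ n : ℕ, 1 ≤ n → n ≤ N →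
      P[G n | ⨆ i ∈ Set.Icc n N, MeasurableSpace.comap (Kc i) inferInstance] =ᵐ[P] 0) ∧
    (∀ n : ℕ, n ≤ N →
      Measurable[⨆ i ∈ Set.Icc (N - n) N, MeasurableSpace.comap (Kc i) inferInstance]
        (fun ω => ∑ k ∈ Finset.Ico (N - n + 1) N, G k ω)) ∧
    (∀ n : ℕ, n ≤ N → Integrable (fun ω => ∑ k ∈ Finset.Ico (N - n + 1) N, G k ω) P) ∧
    (∀ n : ℕ, n + 1 ≤ N →
      P[(fun ω => ∑ k ∈ Finset.Ico (N - (n + 1) + 1) N, G k ω) |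
          ⨆ i ∈ Set.Icc (N - n) N, MeasurableSpace.comap (Kc i) inferInstance]
        =ᵐ[P] fun ω => ∑ k ∈ Finset.Ico (N - n + 1) N, G k ω) := by

  have hpair : ∀ n J L, P.real ({ω | Kc n ω = J} ∩ {ω | Kc (n+1) ω = L}) =
      P.real {ω | Kc n ω = J} * p J L := by
    intro n J L
    refine aux_step P p Kc hKc_meas hMarkov n J L _ ?_ (fun ω hω => hω)
    refine (le_iSup₂_of_le (f := fun i (_ : i ∈ Set.Iic n) =>
      MeasurableSpace.comap (Kc i) inferInstance) n (by simp) le_rfl) _ ?_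
    exact ⟨{J}, measurableSet_singleton J, rfl⟩
  have hm : ∀ n J, MeasurableSet {ω | Kc n ω = J} :=
    fun n J => hKc_meas n (measurableSet_singleton J)
  have hstat : ∀ n J, P.real {ω | Kc n ω = J} = μ J := by
    intro n
    induction n with
    | zero => exact hinit
    | succ n ih =>
      intro J
      have hU : {ω | Kc (n+1) ω = J} = ⋃ I, ({ω | Kc n ω = I} ∩ {ω | Kc (n+1) ω = J}) := by
        ext ω; simp
      have h1 : ∫ ω in {ω | Kc (n+1) ω = J}, (1:ℝ) ∂P =
          ∑' I, ∫ ω in ({ω | Kc n ω = I} ∩ {ω | Kc (n+1) ω = J}), (1:ℝ) ∂P := by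
        conv_lhs => rw [hU]
        refine integral_iUnion (fun I => (hm n I).inter (hm (n+1) J)) ?_
          (integrable_const _).integrableOn
        intro a b hab
        refine Set.disjoint_left.2 ?_
        rintro ω ⟨h1, _⟩ ⟨h2, _⟩
        exact hab (h1.symm.trans h2)
      simp only [integral_const, smul_eq_mul, mul_one, measureReal_restrict_apply_univ, hpair, ih]
        at h1
      rw [h1, ← hμ_inv]
  have hGm : ∀ k, 1 ≤ k → ∀ a b, a + 1 ≤ k → k ≤ b →
      Measurable[⨆ i ∈ Set.Icc a b, MeasurableSpace.comap (Kc i) inferInstance] (G k) := by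
    intro k hk a b ha hb
    have hK : ∀ j ∈ Set.Icc a b,
        Measurable[⨆ i ∈ Set.Icc a b, MeasurableSpace.comap (Kc i) inferInstance] (Kc j) := by
      intro j hj
      exact (comap_measurable (Kc j)).mono (le_iSup₂_of_le (f := fun i (_ : i ∈ Set.Icc a b) =>
        MeasurableSpace.comap (Kc i) inferInstance) j hj le_rfl) le_rfl
    have h1 := hK (k-1) (by simp only [Set.mem_Icc]; omega)
    have h2 := hK k (by simp only [Set.mem_Icc]; omega)
    have h3 := (Measurable.of_discrete (f := fun x : S × S =>
      if x.1 = x.2 then (0 : EuclideanSpace ℝ (Fin d)) else e x.2 - xf x.2 x.1)).comp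
      (h1.prodMk h2)
    convert h3 using 1
    funext ω
    simp [hG k hk]
  have hle : ∀ a b, (⨆ i ∈ Set.Icc a b, MeasurableSpace.comap (Kc i) inferInstance) ≤
      (inferInstance : MeasurableSpace Ω) :=
    fun a b => iSup₂_le fun i _ => (hKc_meas i).comap_le
  have hGint : ∀ k, 1 ≤ k → Integrable (G k) P := by
    intro k hk
    refine Integrable.of_bound
      (((hGm k hk (k-1) k (by omega) le_rfl).mono (hle _ _) le_rfl).aestronglyMeasurable) h ?_
    have hnull : ∀ J L, p J L = 0 → ∀ᵐ ω ∂P, ¬ (Kc (k-1) ω = J ∧ Kc k ω = L) := by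
      intro J L hJL
      have := hpair (k-1) J L
      rw [hJL, mul_zero, Nat.sub_add_cancel hk, measureReal_eq_zero_iff] at this
      rw [ae_iff]
      simpa [Set.ofPred_and] using this
    have hall : ∀ᵐ ω ∂P, ∀ J L, p J L = 0 → ¬ (Kc (k-1) ω = J ∧ Kc k ω = L) := by
      rw [ae_all_iff]; intro J
      rw [ae_all_iff]; intro L
      by_cases hJL : p J L = 0
      · filter_upwards [hnull J L hJL] with ω hω _ using hω
      · exact Filter.Eventually.of_forall fun ω h => absurd h hJL
    filter_upwards [hall] with ω hω
    rw [hG k hk]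
    split_ifs with hc
    · simpa using hh.le
    · refine hclose _ _ (fun h => hc h.symm) ?_
      have hne : p (Kc (k-1) ω) (Kc k ω) ≠ 0 := fun h0 => hω _ _ h0 ⟨rfl, rfl⟩
      exact div_pos (mul_pos (hμ_pos _) (lt_of_le_of_ne (hp_nonneg _ _) hne.symm)) (hμ_pos _)
  have hcent : ∀ n : ℕ, 1 ≤ n → n ≤ N →
      P[G n | ⨆ i ∈ Set.Icc n N, MeasurableSpace.comap (Kc i) inferInstance] =ᵐ[P] 0 := by
    intro n hn hnN
    let Φ : Ω → (Set.Icc n N → S) := fun ω i => Kc i ω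
    have hΦ : Measurable Φ := measurable_pi_lambda _ fun i => hKc_meas i
    have hcomap : (⨆ i ∈ Set.Icc n N, MeasurableSpace.comap (Kc i) inferInstance) =
        MeasurableSpace.comap Φ inferInstance := by
      change _ = MeasurableSpace.comap Φ MeasurableSpace.pi
      rw [MeasurableSpace.pi, MeasurableSpace.comap_iSup, iSup_subtype']
      refine iSup_congr fun i => ?_
      rw [MeasurableSpace.comap_comp]
      rfl
    rw [hcomap]
    refine aux_condExp_zero P Φ hΦ (G n) (hGint n hn) ?_
    intro t
    let s : ℕ → S := fun i => if hi : i ∈ Set.Icc n N then t ⟨i, hi⟩ else t ⟨n, le_rfl, hnN⟩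
    have hC : Φ ⁻¹' {t} = {ω | ∀ i ≤ N - n, Kc (n + i) ω = s (n + i)} := by
      ext ω
      simp only [Set.mem_preimage, Set.mem_singleton_iff, Set.mem_ofPred_eq]
      constructor
      · rintro rfl i hi
        have : n + i ∈ Set.Icc n N := by simp only [Set.mem_Icc]; omega
        simp only [s, dif_pos this, Φ]
      · intro h
        funext ⟨i, hi⟩
        have h' := h (i - n) (by simp only [Set.mem_Icc] at hi; omega)
        rw [Nat.add_sub_cancel' hi.1] at h'
        simpa only [s, dif_pos hi, Φ] using h'
    have hU : Φ ⁻¹' {t} = ⋃ J, ({ω | Kc (n-1) ω = J} ∩ Φ ⁻¹' {t}) := by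
      ext ω; simp
    have hmt : MeasurableSet (Φ ⁻¹' {t}) := hΦ (measurableSet_singleton t)
    rw [hU, integral_iUnion (fun J => (hm (n-1) J).inter hmt) ?_ (hGint n hn).integrableOn]
    swap
    · intro a b hab
      refine Set.disjoint_left.2 ?_
      rintro ω ⟨h1, _⟩ ⟨h2, _⟩
      exact hab (h1.symm.trans h2)
    have hterm : ∀ J, ∫ ω in ({ω | Kc (n-1) ω = J} ∩ Φ ⁻¹' {t}), G n ω ∂P =
        ((∏ i ∈ Finset.range (N - n), p (s (n + i)) (s (n + i + 1))) * μ (s n)) •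
        (if J = s n then 0 else (μ J * p J (s n) / μ (s n)) • (e (s n) - xf (s n) J)) := by
      intro J
      have h1 : ∫ ω in ({ω | Kc (n-1) ω = J} ∩ Φ ⁻¹' {t}), G n ω ∂P =
          ∫ ω in ({ω | Kc (n-1) ω = J} ∩ Φ ⁻¹' {t}),
            (if J = s n then 0 else e (s n) - xf (s n) J) ∂P := by
        refine setIntegral_congr_fun ((hm (n-1) J).inter hmt) ?_
        rintro ω ⟨h1, h2⟩
        rw [hC] at h2
        have h2' := h2 0 (Nat.zero_le _)
        simp only [Set.mem_ofPred_eq, add_zero] at h1 h2'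
        simp only [hG n hn, h1, h2']
      have h2 := (aux_cyl P p Kc hKc_meas hMarkov n s {ω | Kc (n-1) ω = J} (by
        refine (le_iSup₂_of_le (f := fun i (_ : i ∈ Set.Iic n) =>
          MeasurableSpace.comap (Kc i) inferInstance) (n-1) (by simp) le_rfl) _ ?_
        exact ⟨{J}, measurableSet_singleton J, rfl⟩) (N - n)).2
      have h3 := hpair (n-1) J (s n)
      rw [Nat.sub_add_cancel hn, hstat] at h3
      rw [h1, setIntegral_const, hC, h2, h3]
      split_ifs with hJ
      · simp
      · rw [smul_smul]
        congr 1
        have := (hμ_pos (s n)).ne'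
        field_simp
    simp_rw [hterm]
    rw [tsum_const_smul'', hbar, smul_zero]
  have hMm : ∀ n : ℕ, n ≤ N →
      Measurable[⨆ i ∈ Set.Icc (N - n) N, MeasurableSpace.comap (Kc i) inferInstance]
        (fun ω => ∑ k ∈ Finset.Ico (N - n + 1) N, G k ω) := by
    intro n hn
    refine Finset.measurable_fun_sum _ fun k hk => ?_
    rw [Finset.mem_Ico] at hk
    exact hGm k (by omega) _ _ hk.1 hk.2.le
  have hMi : ∀ n : ℕ, n ≤ N →
      Integrable (fun ω => ∑ k ∈ Finset.Ico (N - n + 1) N, G k ω) P := by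
    intro n hn
    refine integrable_finsetSum _ fun k hk => hGint k ?_
    rw [Finset.mem_Ico] at hk
    omega
  refine ⟨hcent, hMm, hMi, ?_⟩
  intro n hn
  have hsm := condExp_of_stronglyMeasurable (μ := P) (hle (N - n) N)
    (hMm n (by omega)).stronglyMeasurable (hMi n (by omega))
  have hidx : N - (n + 1) + 1 = N - n := by omega
  rw [hidx]
  rcases Nat.eq_zero_or_pos n with rfl | hpos
  · have : (fun ω => ∑ k ∈ Finset.Ico (N - 0) N, G k ω) = fun ω => 0 := by
      funext ω; simp
    rw [this]
    simp only [Nat.sub_zero, Finset.Ico_eq_empty_of_le (Nat.le_succ N), Finset.sum_empty]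
    exact Filter.EventuallyEq.of_eq condExp_zero
  · have hsplit : (fun ω => ∑ k ∈ Finset.Ico (N - n) N, G k ω) =
        G (N - n) + fun ω => ∑ k ∈ Finset.Ico (N - n + 1) N, G k ω := by
      funext ω
      rw [Pi.add_apply, Finset.sum_eq_sum_Ico_succ_bot (by omega)]
    rw [hsplit]
    refine (condExp_add (hGint (N - n) (by omega)) (hMi n (by omega)) _).trans ?_
    rw [hsm]
    filter_upwards [hcent (N - n) (by omega) (by omega)] with ω hω
    rw [Pi.add_apply, hω, Pi.zero_apply, zero_add]
end

section
/- Let S be a countable set, Δt > 0, (p_{K,L})_{K,L∈S} a stochastic matrix, (q_{K,J})_{K≠J} a family of nonnegative reals with Σ_{J≠K} q_{K,J} < ∞ for each K, and (δ_K)_{K∈S} reals with 1 + δ_K Δt > 0, satisfying for every K the relation −Σ_{L≠K} p_{K,L} + Σ_{J≠K} q_{K,J} = δ_K Δt. Define γ_{K,J} = (1 + δ_K Δt)^{-1} q_{K,J} for J ≠ K and γ_{K,K} = 1 − Σ_{J≠K} γ_{K,J}. Then γ_{K,K} = (1 + δ_K Δt)^{-1} p_{K,K} for every K; in particular γ_{K,J}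 ≥ 0 for all K, J and Σ_J γ_{K,J} = 1, i.e. γ is a stochastic matrix. -/
open MeasureTheory

/-- **Renormalization of the reversed weights into a Markovian kernel.**
`p` is a stochastic matrix on a countable set `S`, `q` a family of nonnegative
off-diagonal weights with summable rows, and `δ K` reals with `1 + δ K Δt > 0`,
satisfying `−∑_{L≠K} p K L + ∑_{J≠K} q K J = δ K Δt` for all `K`.  Defining
`γ K J = (1 + δ K Δt)⁻¹ q K J` for `J ≠ K` and `γ K K = 1 − ∑_{J≠K} γ K J`,
one has `γ K K = (1 + δ K Δt)⁻¹ p K K`; in particular `γ` is a stochastic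
matrix. -/
theorem stmt_8
    {S : Type*} [Countable S] [DecidableEq S]
    (Δt : ℝ) (hΔt : 0 < Δt)
    (p : S → S → ℝ)
    (hp_nonneg : ∀ K L, 0 ≤ p K L)
    (hp_row : ∀ K, ∑' L, p K L = 1)
    (q : S → S → ℝ)
    (hq_nonneg : ∀ K J, J ≠ K → 0 ≤ q K J)
    (hq_summable : ∀ K, Summable fun J => if J = K then 0 else q K J)
    (δ : S → ℝ) (hδ : ∀ K, 0 < 1 + δ K * Δt)
    (hrel : ∀ K, -(∑' L, if L = K then 0 else p K L) + (∑' J, if J = K then 0 else q K J)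
      = δ K * Δt)
    (γ : S → S → ℝ)
    (hγ_off : ∀ K J, J ≠ K → γ K J = (1 + δ K * Δt)⁻¹ * q K J)
    (hγ_diag : ∀ K, γ K K = 1 - ∑' J, (if J = K then 0 else γ K J)) :
    (∀ K, γ K K = (1 + δ K * Δt)⁻¹ * p K K) ∧
    (∀ K J, 0 ≤ γ K J) ∧
    (∀ K, ∑' J, γ K J = 1) := by
  have hfun : ∀ K, (fun J => if J = K then 0 else γ K J)
      = fun J => (1 + δ K * Δt)⁻¹ * (if J = K then 0 else q K J) := by
    intro K
    funext J
    by_cases h : J = K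
    · simp [h]
    · simp [h, hγ_off K J h]
  have hdiag : ∀ K, γ K K = (1 + δ K * Δt)⁻¹ * p K K := by
    intro K
    have hps : Summable (p K) := by
      by_contra h
      have h1 := hp_row K
      rw [tsum_eq_zero_of_not_summable h] at h1
      exact zero_ne_one h1
    have h1 := hps.tsum_eq_add_tsum_ite K
    rw [hp_row K] at h1
    have h2 := hrel K
    have h0 := (hδ K).ne'
    rw [hγ_diag K, hfun K, tsum_mul_left]
    have h3 : (∑' J, if J = K then 0 else q K J) = (1 + δ K * Δt) - p K K := by linarith
    rw [h3, mul_sub, inv_mul_cancel₀ h0]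
    ring
  refine ⟨hdiag, ?_, ?_⟩
  · intro K J
    by_cases h : J = K
    · subst h
      rw [hdiag]
      exact mul_nonneg (inv_nonneg.mpr (hδ _).le) (hp_nonneg _ _)
    · rw [hγ_off K J h]
      exact mul_nonneg (inv_nonneg.mpr (hδ _).le) (hq_nonneg _ _ h)
  · intro K
    have hs1 : Summable (fun J => if J = K then 0 else γ K J) := by
      rw [hfun K]
      exact (hq_summable K).mul_left _
    have hs : Summable (γ K) := by
      have h2 := hs1.add (hasSum_ite_eq K (γ K K)).summable
      refine h2.congr ?_
      intro J
      by_cases h : J = K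
      · simp [h]
      · simp [h]
    rw [hs.tsum_eq_add_tsum_ite K, hγ_diag K]
    ring
end

section
/- Let S be a countable set, Δt > 0, N ≥ 1, (p_{K,L})_{K,L∈S} and (γ_{K,J})_{K,J∈S} two stochastic matrices, m : S → (0,∞), (δ_K)_{K∈S} reals, D ≥ 0 and β ≥ 1, h > 0, such that: |δ_K| ≤ D for all K, D Δt < 1, β^{-1} h^d ≤ m_K ≤ h^d for all K, and γ_{K,J} (1 + δ_K Δt) m_K = m_J p_{J,K} for all K, J ∈ S. Let (K_n)_{n≥0} be a Markov chain with transition matrix p started at K (under a measure P_K with expectation E_K) and let (Γ_n)_{n≥0} be a Markov chain with transition matrix γ started at L (under a measure Q_L with expectation E^Q_L). Then for every nonnegative function Ψ : S^{N+1} → ℝ and every pair of states K, L ∈ S: β^{-1}(1 − DΔt)^N E^Q_L[Ψ(Γ_0,…,Γ_N) 1_{{Γ_N = K}}] ≤ E_K[Ψ(K_N, K_{N−1}, …, K_0) 1_{{K_N = L}}] ≤ β (1 + DΔt)^N E^Q_L[Ψ(Γ_0,…,Γ_N) 1_{{Γ_N = K}}]. -/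
open MeasureTheory

/-- Path probabilities of a Markov chain. -/
theorem path_prob {S : Type*} [Countable S] [DecidableEq S] [MeasurableSpace S]
    [MeasurableSingletonClass S] (p : S → S → ℝ) (x : S)
    {Ω : Type*} [mΩ : MeasurableSpace Ω] (P : Measure Ω) [IsProbabilityMeasure P]
    (X : ℕ → Ω → S) (hX : ∀ n, Measurable (X n))
    (h0 : ∀ᵐ ω ∂P, X 0 ω = x)
    (hM : ∀ (n : ℕ) (J : S),
      P[(Set.indicator {ω | X (n + 1) ω = J} fun _ => (1 : ℝ)) |
          ⨆ i ∈ Set.Iic n, MeasurableSpace.comap (X i) inferInstance]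
        =ᵐ[P] fun ω => p (X n ω) J)
    (s : ℕ → S) (n : ℕ) :
    P.real {ω | ∀ i ≤ n, X i ω = s i} =
      if s 0 = x then ∏ i ∈ Finset.range n, p (s i) (s (i + 1)) else 0 := by
  induction n with
  | zero =>
    by_cases hs : s 0 = x
    · have : P {ω | ∀ i ≤ 0, X i ω = s i} = 1 := by
        rw [← mem_ae_iff_prob_eq_one₀]
        · filter_upwards [h0] with ω hω
          simp [hω, hs]
        · refine MeasurableSet.nullMeasurableSet ?_
          have e : {ω | ∀ i ≤ 0, X i ω = s i} = X 0 ⁻¹' {s 0} := by ext ω; simp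
          rw [e]
          exact (hX 0) (measurableSet_singleton (s 0))
      rw [Measure.real, this]; simp [hs]
    · have : P {ω | ∀ i ≤ 0, X i ω = s i} = 0 := by
        rw [measure_eq_zero_iff_ae_notMem]
        filter_upwards [h0] with ω hω
        simp [hω, Ne.symm hs]
      rw [Measure.real, this]; simp [hs]
  | succ n ih =>
    set A : Set Ω := {ω | ∀ i ≤ n, X i ω = s i} with hA
    have hle : (⨆ i ∈ Set.Iic n, MeasurableSpace.comap (X i) inferInstance) ≤ mΩ := by
      refine iSup₂_le fun i _ => (hX i).comap_le
    have hAm : MeasurableSet[⨆ i ∈ Set.Iic n, MeasurableSpace.comap (X i) inferInstance] A := by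
      have : A = ⋂ i ∈ Set.Iic n, X i ⁻¹' {s i} := by ext ω; simp [hA]
      rw [this]
      refine @MeasurableSet.biInter _ _ (_) _ _ (Set.to_countable _) fun i hi => ?_
      have h1 : MeasurableSpace.comap (X i) inferInstance ≤ (⨆ i ∈ Set.Iic n, MeasurableSpace.comap (X i) inferInstance) :=
        le_iSup₂_of_le (f := fun i (_ : i ∈ Set.Iic n) =>
          MeasurableSpace.comap (X i) inferInstance) i hi le_rfl
      exact h1 _ ⟨{s i}, measurableSet_singleton _, rfl⟩
    have hB : MeasurableSet {ω | X (n + 1) ω = s (n + 1)} :=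
      (hX (n + 1)) (measurableSet_singleton (s (n + 1)))
    have hint : Integrable (Set.indicator {ω | X (n + 1) ω = s (n + 1)} fun _ => (1 : ℝ)) P :=
      (integrable_const 1).indicator hB
    have key := setIntegral_condExp hle hint hAm
    have e1 : ∫ ω in A, (P[(Set.indicator {ω | X (n + 1) ω = s (n + 1)} fun _ => (1 : ℝ)) | (⨆ i ∈ Set.Iic n, MeasurableSpace.comap (X i) inferInstance)]) ω ∂P
        = P.real A * p (s n) (s (n + 1)) := by
      have : ∫ ω in A, (P[(Set.indicator {ω | X (n + 1) ω = s (n + 1)} fun _ => (1 : ℝ)) | (⨆ i ∈ Set.Iic n, MeasurableSpace.comap (X i) inferInstance)]) ω ∂P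
        = ∫ ω in A, p (s n) (s (n + 1)) ∂P := by
        refine setIntegral_congr_ae (hle _ hAm) ?_
        filter_upwards [hM n (s (n + 1))] with ω hω hωA
        rw [hω, hωA n le_rfl]
      rw [this]; simp
    have e2 : {ω | ∀ i ≤ n + 1, X i ω = s i} = {ω | X (n + 1) ω = s (n + 1)} ∩ A := by
      ext ω
      simp only [hA, Set.mem_ofPred_eq, Set.mem_inter_iff]
      constructor
      · exact fun h => ⟨h _ le_rfl, fun i hi => h i (by omega)⟩
      · rintro ⟨h1, h2⟩ i hi
        rcases Nat.lt_or_ge n i with h | h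
        · obtain rfl : i = n + 1 := by omega
          exact h1
        · exact h2 i h
    rw [e1, integral_indicator_const _ hB] at key
    rw [e2, ← measureReal_restrict_apply hB, Finset.prod_range_succ]
    simp only [smul_eq_mul, mul_one] at key
    rw [← key, ih]
    split_ifs <;> simp

/-- Integrals of functions of a countably valued map. -/
theorem lintegral_path {T : Type*} [Countable T] [MeasurableSpace T] [MeasurableSingletonClass T]
    {Ω : Type*} [MeasurableSpace Ω] (P : Measure Ω) (X : Ω → T) (hX : Measurable X)
    (F : T → ENNReal) : ∫⁻ ω, F (X ω) ∂P = ∑' s, F s * P {ω | X ω = s} := by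
  rw [← lintegral_map (f := F) (measurable_of_countable F) hX, lintegral_countable']
  refine tsum_congr fun s => ?_
  rw [Measure.map_apply hX (measurableSet_singleton s)]
  rfl

/-- **Comparison of the time-reversed chain with the chain of the renormalized
reversed kernel.**  `p` and `γ` are stochastic matrices on a countable set `S`,
`m K ∈ [β⁻¹ h^d, h^d]` are positive masses, `|δ K| ≤ D` with `D Δt < 1`, and
`γ K J (1 + δ K Δt) m K = m J p J K`.  If `(Kc n)` is a `p`-chain started at `K`
under `P` and `(Γ n)` a `γ`-chain started at `L` under `Q`, then for every
nonnegative `Ψ : S^{N+1} → ℝ`,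
`β⁻¹ (1 − DΔt)^N E^Q_L[Ψ(Γ_0,…,Γ_N) 1_{Γ_N = K}]
  ≤ E_K[Ψ(K_N,…,K_0) 1_{K_N = L}]
  ≤ β (1 + DΔt)^N E^Q_L[Ψ(Γ_0,…,Γ_N) 1_{Γ_N = K}]`. -/
theorem stmt_9
    {S : Type*} [Countable S] [DecidableEq S] [MeasurableSpace S] [MeasurableSingletonClass S]
    (d : ℕ) (hd : 1 ≤ d) (Δt h : ℝ) (hΔt : 0 < Δt) (hh : 0 < h)
    (N : ℕ) (hN : 1 ≤ N)
    (p γ : S → S → ℝ)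
    (hp_nonneg : ∀ K L, 0 ≤ p K L) (hp_row : ∀ K, ∑' L, p K L = 1)
    (hγ_nonneg : ∀ K L, 0 ≤ γ K L) (hγ_row : ∀ K, ∑' L, γ K L = 1)
    (m : S → ℝ) (hm_pos : ∀ K, 0 < m K)
    (δ : S → ℝ) (D β : ℝ) (hD : 0 ≤ D) (hβ : 1 ≤ β)
    (hδ : ∀ K, |δ K| ≤ D) (hDΔt : D * Δt < 1)
    (hm_lb : ∀ K, β⁻¹ * h ^ d ≤ m K) (hm_ub : ∀ K, m K ≤ h ^ d)
    (hrel : ∀ K J, γ K J * (1 + δ K * Δt) * m K = m J * p J K)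
    (K L : S)
    {Ω : Type*} [MeasurableSpace Ω] (P : Measure Ω) [IsProbabilityMeasure P]
    (Kc : ℕ → Ω → S) (hKc_meas : ∀ n, Measurable (Kc n))
    (hKstart : ∀ᵐ ω ∂P, Kc 0 ω = K)
    (hKMarkov : ∀ (n : ℕ) (J : S),
      P[(Set.indicator {ω | Kc (n + 1) ω = J} fun _ => (1 : ℝ)) |
          ⨆ i ∈ Set.Iic n, MeasurableSpace.comap (Kc i) inferInstance]
        =ᵐ[P] fun ω => p (Kc n ω) J)
    {Ω' : Type*} [MeasurableSpace Ω'] (Q : Measure Ω') [IsProbabilityMeasure Q]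
    (Γ : ℕ → Ω' → S) (hΓ_meas : ∀ n, Measurable (Γ n))
    (hΓstart : ∀ᵐ ω ∂Q, Γ 0 ω = L)
    (hΓMarkov : ∀ (n : ℕ) (J : S),
      Q[(Set.indicator {ω | Γ (n + 1) ω = J} fun _ => (1 : ℝ)) |
          ⨆ i ∈ Set.Iic n, MeasurableSpace.comap (Γ i) inferInstance]
        =ᵐ[Q] fun ω => γ (Γ n ω) J)
    (Ψ : (Fin (N + 1) → S) → ℝ) (hΨ_nonneg : ∀ s, 0 ≤ Ψ s) :
    ENNReal.ofReal (β⁻¹ * (1 - D * Δt) ^ N) *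
        ∫⁻ ω, ENNReal.ofReal (if Γ N ω = K then Ψ (fun i => Γ (i : ℕ) ω) else 0) ∂Q
      ≤ (∫⁻ ω, ENNReal.ofReal (if Kc N ω = L then Ψ (fun i => Kc (N - (i : ℕ)) ω) else 0) ∂P) ∧
    (∫⁻ ω, ENNReal.ofReal (if Kc N ω = L then Ψ (fun i => Kc (N - (i : ℕ)) ω) else 0) ∂P)
      ≤ ENNReal.ofReal (β * (1 + D * Δt) ^ N) *
        ∫⁻ ω, ENNReal.ofReal (if Γ N ω = K then Ψ (fun i => Γ (i : ℕ) ω) else 0) ∂Q := by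
  have hP : ∫⁻ ω, ENNReal.ofReal (if Kc N ω = L then Ψ (fun i => Kc (N - (i : ℕ)) ω) else 0) ∂P
      = ∑' s : Fin (N + 1) → S, ENNReal.ofReal (if s 0 = L then Ψ s else 0) *
          P {ω | (fun i : Fin (N + 1) => Kc (N - (i : ℕ)) ω) = s} :=
    lintegral_path P (fun ω (i : Fin (N + 1)) => Kc (N - (i : ℕ)) ω)
      (measurable_pi_lambda _ fun i => hKc_meas _)
      (fun s => ENNReal.ofReal (if s 0 = L then Ψ s else 0))
  have hQ : ∫⁻ ω, ENNReal.ofReal (if Γ N ω = K then Ψ (fun i => Γ (i : ℕ) ω) else 0) ∂Q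
      = ∑' s : Fin (N + 1) → S, ENNReal.ofReal (if s (Fin.last N) = K then Ψ s else 0) *
          Q {ω | (fun i : Fin (N + 1) => Γ (i : ℕ) ω) = s} :=
    lintegral_path Q (fun ω (i : Fin (N + 1)) => Γ (i : ℕ) ω)
      (measurable_pi_lambda _ fun i => hΓ_meas _)
      (fun s => ENNReal.ofReal (if s (Fin.last N) = K then Ψ s else 0))
  have hβ0 : 0 < β := by linarith
  have hDt : 0 ≤ D * Δt := mul_nonneg hD hΔt.le
  have hlo : 0 ≤ β⁻¹ * (1 - D * Δt) ^ N :=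
    mul_nonneg (inv_nonneg.2 hβ0.le) (pow_nonneg (by linarith) _)
  have hhi : 0 ≤ β * (1 + D * Δt) ^ N :=
    mul_nonneg hβ0.le (pow_nonneg (by linarith) _)
  -- the termwise comparison of path weights
  have hfac : ∀ J, 1 - D * Δt ≤ 1 + δ J * Δt ∧ 1 + δ J * Δt ≤ 1 + D * Δt := by
    intro J
    have := abs_le.1 (hδ J)
    constructor <;> nlinarith
  have hmass : ∀ I J, m I ≤ β * m J := by
    intro I J
    have h1 := hm_ub I
    have h2 := mul_le_mul_of_nonneg_left (hm_lb J) hβ0.le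
    rw [← mul_assoc, mul_inv_cancel₀ hβ0.ne', one_mul] at h2
    linarith
  have hprod : ∀ t : ℕ → S,
      β⁻¹ * (1 - D * Δt) ^ N * ∏ j ∈ Finset.range N, γ (t j) (t (j + 1)) ≤
        ∏ j ∈ Finset.range N, p (t (j + 1)) (t j) ∧
      ∏ j ∈ Finset.range N, p (t (j + 1)) (t j) ≤
        β * (1 + D * Δt) ^ N * ∏ j ∈ Finset.range N, γ (t j) (t (j + 1)) := by
    intro t
    have hid : ∀ n, m (t n) * ∏ j ∈ Finset.range n, p (t (j + 1)) (t j) =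
        m (t 0) * ((∏ j ∈ Finset.range n, (1 + δ (t j) * Δt)) *
          ∏ j ∈ Finset.range n, γ (t j) (t (j + 1))) := by
      intro n
      induction n with
      | zero => simp
      | succ n ih =>
        simp only [Finset.prod_range_succ]
        have := hrel (t n) (t (n + 1))
        calc _ = (∏ j ∈ Finset.range n, p (t (j + 1)) (t j)) *
              (m (t (n + 1)) * p (t (n + 1)) (t n)) := by ring
          _ = (m (t n) * ∏ j ∈ Finset.range n, p (t (j + 1)) (t j)) *
              (γ (t n) (t (n + 1)) * (1 + δ (t n) * Δt)) := by rw [← this]; ring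
          _ = _ := by rw [ih]; ring
    have hidN := hid N
    set A := ∏ j ∈ Finset.range N, p (t (j + 1)) (t j)
    set G := ∏ j ∈ Finset.range N, γ (t j) (t (j + 1))
    have hG : 0 ≤ G := Finset.prod_nonneg fun _ _ => hγ_nonneg _ _
    have hA : 0 ≤ A := Finset.prod_nonneg fun _ _ => hp_nonneg _ _
    set E := ∏ j ∈ Finset.range N, (1 + δ (t j) * Δt)
    have hE1 : (1 - D * Δt) ^ N ≤ E := by
      have := Finset.prod_le_prod (s := Finset.range N) (f := fun _ => 1 - D * Δt)
        (g := fun j => 1 + δ (t j) * Δt) (fun _ _ => by linarith) (fun j _ => (hfac (t j)).1)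
      simpa using this
    have hE2 : E ≤ (1 + D * Δt) ^ N := by
      have := Finset.prod_le_prod (s := Finset.range N) (f := fun j => 1 + δ (t j) * Δt)
        (g := fun _ => 1 + D * Δt) (fun j _ => by linarith [(hfac (t j)).1])
        (fun j _ => (hfac (t j)).2)
      simpa using this
    have hE0 : 0 ≤ E := le_trans (pow_nonneg (by linarith) _) hE1
    have hEG : 0 ≤ E * G := mul_nonneg hE0 hG
    constructor
    · have h1 : E * G ≤ β * A := by
        refine le_of_mul_le_mul_left ?_ (hm_pos (t 0))
        rw [← hidN]
        nlinarith [mul_le_mul_of_nonneg_right (hmass (t N) (t 0)) hA]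
      have h2 : (1 - D * Δt) ^ N * G ≤ β * A :=
        (mul_le_mul_of_nonneg_right hE1 hG).trans h1
      rw [mul_assoc, inv_mul_le_iff₀ hβ0]
      exact h2
    · have h1 : A ≤ β * (E * G) := by
        refine le_of_mul_le_mul_left ?_ (hm_pos (t N))
        rw [hidN]
        nlinarith [mul_le_mul_of_nonneg_right (hmass (t 0) (t N)) hEG]
      rw [mul_assoc]
      exact h1.trans (mul_le_mul_of_nonneg_left (mul_le_mul_of_nonneg_right hE2 hG) hβ0.le)
  have hterm : ∀ s : Fin (N + 1) → S,
      ENNReal.ofReal (β⁻¹ * (1 - D * Δt) ^ N) *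
        (ENNReal.ofReal (if s (Fin.last N) = K then Ψ s else 0) *
          Q {ω | (fun i : Fin (N + 1) => Γ (i : ℕ) ω) = s}) ≤
        ENNReal.ofReal (if s 0 = L then Ψ s else 0) *
          P {ω | (fun i : Fin (N + 1) => Kc (N - (i : ℕ)) ω) = s} ∧
      ENNReal.ofReal (if s 0 = L then Ψ s else 0) *
          P {ω | (fun i : Fin (N + 1) => Kc (N - (i : ℕ)) ω) = s} ≤
        ENNReal.ofReal (β * (1 + D * Δt) ^ N) *
        (ENNReal.ofReal (if s (Fin.last N) = K then Ψ s else 0) *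
          Q {ω | (fun i : Fin (N + 1) => Γ (i : ℕ) ω) = s}) := by
    intro s
    set t : ℕ → S := fun i => if h : i < N + 1 then s ⟨i, h⟩ else K with ht
    have hts : ∀ i : Fin (N + 1), t i = s i := by
      intro i; simp only [ht]; rw [dif_pos i.2]
    have ht0 : t 0 = s 0 := hts 0
    have htN : t N = s (Fin.last N) := hts (Fin.last N)
    have hQs : {ω | (fun i : Fin (N + 1) => Γ (i : ℕ) ω) = s} = {ω | ∀ i ≤ N, Γ i ω = t i} := by
      ext ω
      simp only [Set.mem_ofPred_eq, funext_iff]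
      constructor
      · intro h i hi
        have := h ⟨i, by omega⟩
        rw [← hts] at this
        exact this
      · intro h i
        rw [← hts]
        exact h i (by omega)
    have hPs : {ω | (fun i : Fin (N + 1) => Kc (N - (i : ℕ)) ω) = s} =
        {ω | ∀ i ≤ N, Kc i ω = (fun j => t (N - j)) i} := by
      ext ω
      simp only [Set.mem_ofPred_eq, funext_iff]
      constructor
      · intro h i hi
        have := h ⟨N - i, by omega⟩
        rw [← hts] at this
        simpa [Nat.sub_sub_self hi] using this
      · intro h i
        rw [← hts]
        have := h (N - i) (by omega)
        rwa [Nat.sub_sub_self (by omega)] at this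
    have hPv := path_prob p K P Kc hKc_meas hKstart hKMarkov (fun j => t (N - j)) N
    have hQv := path_prob γ L Q Γ hΓ_meas hΓstart hΓMarkov t N
    have hrefl : ∏ i ∈ Finset.range N, p (t (N - i)) (t (N - (i + 1))) =
        ∏ j ∈ Finset.range N, p (t (j + 1)) (t j) := by
      rw [← Finset.prod_range_reflect]
      refine Finset.prod_congr rfl fun i hi => ?_
      have := Finset.mem_range.1 hi
      congr 2 <;> omega
    simp only [Nat.sub_zero] at hPv
    simp only [hrefl, htN] at hPv
    simp only [ht0] at hQv
    rw [hQs, hPs, ← ofReal_measureReal (μ := P), ← ofReal_measureReal (μ := Q), hPv, hQv]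
    by_cases hK : s (Fin.last N) = K
    · by_cases hL : s 0 = L
      · simp only [hK, hL, if_true]
        obtain ⟨h1, h2⟩ := hprod t
        rw [← ENNReal.ofReal_mul (hΨ_nonneg s), ← ENNReal.ofReal_mul (hΨ_nonneg s),
          ← ENNReal.ofReal_mul hlo, ← ENNReal.ofReal_mul hhi]
        constructor <;> apply ENNReal.ofReal_le_ofReal
        · nlinarith [mul_le_mul_of_nonneg_left h1 (hΨ_nonneg s)]
        · nlinarith [mul_le_mul_of_nonneg_left h2 (hΨ_nonneg s)]
      · simp [hK, hL]
    · simp [hK]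
  rw [hP, hQ, ← ENNReal.tsum_mul_left, ← ENNReal.tsum_mul_left]
  exact ⟨ENNReal.tsum_le_tsum fun s => (hterm s).1, ENNReal.tsum_le_tsum fun s => (hterm s).2⟩
end

section
/- Let S be a countable set, d ≥ 1, Δt > 0, h > 0, (q_{K,J})_{K≠J} nonnegative reals and (δ_K)_{K∈S} reals with 1 + δ_K Δt > 0, and let γ be the stochastic matrix defined by γ_{K,J} = (1 + δ_K Δt)^{-1} q_{K,J} for J ≠ K and γ_{K,K} = 1 − Σ_{J≠K} γ_{K,J} ≥ 0. Suppose given points x_{K,J} ∈ ℝ^d for distinct K, J and e_K ∈ ℝ^d for K ∈ S with |e_K − x_{K,J}| ≤ h whenever q_{K,J} > 0, satisfying the barycenter condition Σ_{J≠K} q_{K,J}(e_K − x_{K,J}) = 0 for every K. Let (Γ_n)_{n≥0} be a Markov chain with transition matrix γ started at a state L, under a measure Q_L. Define Ξ_0 = 0 and Ξ_n = Σ_{i=0}^{n−1} (e_{Γ_i} − x_{Γ_i,Γ_{i+1}}) 1_{{Γ_{i+1} ≠ Γ_i}} for n ≥ 1. Then (Ξ_n)_{n≥0} is a martingale under Q_L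 with respect to the filtration (σ(Γ_0,…,Γ_n))_{n≥0}. -/
open MeasureTheory

/-- **The accumulated gap of the reversed random characteristic is a
martingale.**  `q` is a family of nonnegative off-diagonal weights, `δ K` reals
with `1 + δ K Δt > 0`, and `γ` the stochastic matrix
`γ K J = (1 + δ K Δt)⁻¹ q K J` (`J ≠ K`), `γ K K = 1 − ∑_{J≠K} γ K J ≥ 0`.
Points `xf K J ∈ ℝ^d` and `e K ∈ ℝ^d` satisfy `‖e K − xf K J‖ ≤ h` whenever
`q K J > 0`, and the barycenter condition `∑_{J≠K} q K J • (e K − xf K J) = 0`.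
If `(Γ n)` is a Markov chain with transition matrix `γ` started at `L` under
`Q`, then `Ξ n = ∑_{i<n} (e (Γ i) − xf (Γ i) (Γ (i+1))) 1_{Γ (i+1) ≠ Γ i}` is a
martingale under `Q` with respect to the filtration `σ(Γ 0, …, Γ n)`. -/
theorem stmt_10
    {S : Type*} [Countable S] [DecidableEq S] [MeasurableSpace S] [MeasurableSingletonClass S]
    (d : ℕ) (hd : 1 ≤ d) (Δt h : ℝ) (hΔt : 0 < Δt) (hh : 0 < h)
    (q : S → S → ℝ)
    (hq_nonneg : ∀ K J, J ≠ K → 0 ≤ q K J)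
    (hq_summable : ∀ K, Summable fun J => if J = K then 0 else q K J)
    (δ : S → ℝ) (hδ : ∀ K, 0 < 1 + δ K * Δt)
    (γ : S → S → ℝ)
    (hγ_off : ∀ K J, J ≠ K → γ K J = (1 + δ K * Δt)⁻¹ * q K J)
    (hγ_diag : ∀ K, γ K K = 1 - ∑' J, (if J = K then 0 else γ K J))
    (hγ_diag_nonneg : ∀ K, 0 ≤ γ K K)
    (e : S → EuclideanSpace ℝ (Fin d)) (xf : S → S → EuclideanSpace ℝ (Fin d))
    (hclose : ∀ K J, K ≠ J → 0 < q K J → ‖e K - xf K J‖ ≤ h)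
    (hbar : ∀ K, ∑' J, (if J = K then 0 else q K J • (e K - xf K J)) = 0)
    (L : S)
    {Ω : Type*} [MeasurableSpace Ω] (Q : Measure Ω) [IsProbabilityMeasure Q]
    (Γ : ℕ → Ω → S) (hΓ_meas : ∀ n, Measurable (Γ n))
    (hstart : ∀ᵐ ω ∂Q, Γ 0 ω = L)
    (hMarkov : ∀ (n : ℕ) (J : S),
      Q[(Set.indicator {ω | Γ (n + 1) ω = J} fun _ => (1 : ℝ)) |
          ⨆ i ∈ Set.Iic n, MeasurableSpace.comap (Γ i) inferInstance]
        =ᵐ[Q] fun ω => γ (Γ n ω) J)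
    (Ξ : ℕ → Ω → EuclideanSpace ℝ (Fin d))
    (hΞ : ∀ (n : ℕ) (ω : Ω), Ξ n ω = ∑ i ∈ Finset.range n,
      (if Γ (i + 1) ω = Γ i ω then 0 else e (Γ i ω) - xf (Γ i ω) (Γ (i + 1) ω))) :
    (∀ n : ℕ, Measurable[⨆ i ∈ Set.Iic n, MeasurableSpace.comap (Γ i) inferInstance] (Ξ n)) ∧
    (∀ n : ℕ, Integrable (Ξ n) Q) ∧
    (∀ n : ℕ,
      Q[Ξ (n + 1) | ⨆ i ∈ Set.Iic n, MeasurableSpace.comap (Γ i) inferInstance]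
        =ᵐ[Q] Ξ n) := by
  classical
  set m : ℕ → MeasurableSpace Ω :=
    fun n => ⨆ i ∈ Set.Iic n, MeasurableSpace.comap (Γ i) inferInstance with hm_def
  have hm : ∀ n, m n ≤ (inferInstance : MeasurableSpace Ω) := fun n =>
    iSup₂_le fun i _ => (hΓ_meas i).comap_le
  have hΓm : ∀ n i, i ≤ n → Measurable[m n] (Γ i) := by
    intro n i hi
    refine Measurable.mono (comap_measurable (Γ i)) ?_ le_rfl
    exact le_iSup₂_of_le (f := fun i (_ : i ∈ Set.Iic n) =>
      MeasurableSpace.comap (Γ i) inferInstance) i hi le_rfl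
  let g : S → S → EuclideanSpace ℝ (Fin d) := fun K J => if J = K then 0 else e K - xf K J
  let D : ℕ → Ω → EuclideanSpace ℝ (Fin d) := fun n ω => g (Γ n ω) (Γ (n + 1) ω)
  have hDm : ∀ n i, i + 1 ≤ n → Measurable[m n] (D i) := by
    intro n i hi
    have h1 : Measurable[m n] (fun ω => (Γ i ω, Γ (i + 1) ω)) :=
      (hΓm n i (by omega)).prodMk (hΓm n (i + 1) hi)
    exact (measurable_of_countable (fun p : S × S => g p.1 p.2)).comp h1
  have hD : ∀ n, Measurable (D n) := fun n => (hDm (n + 1) n le_rfl).mono (hm _) le_rfl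
  have hΞ' : ∀ n, Ξ n = fun ω => ∑ i ∈ Finset.range n, D i ω := by
    intro n; funext ω; rw [hΞ]
  have hΞm : ∀ n, Measurable[m n] (Ξ n) := by
    intro n
    rw [hΞ' n]
    refine Finset.measurable_fun_sum _ fun i hi => hDm n i ?_
    have := Finset.mem_range.1 hi
    omega
  have hset : ∀ n J, MeasurableSet {ω | Γ n ω = J} := fun n J =>
    hΓ_meas n (measurableSet_singleton J)
  -- joint law
  have hjoint : ∀ n (A : Set Ω), MeasurableSet[m n] A → ∀ K J,
      Q.real ((A ∩ {ω | Γ n ω = K}) ∩ {ω | Γ (n + 1) ω = J})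
        = Q.real (A ∩ {ω | Γ n ω = K}) * γ K J := by
    intro n A hA K J
    have hKm : MeasurableSet[m n] {ω | Γ n ω = K} :=
      hΓm n n le_rfl (measurableSet_singleton K)
    have hB : MeasurableSet[m n] (A ∩ {ω | Γ n ω = K}) := MeasurableSet.inter hA hKm
    have hint : Integrable (Set.indicator {ω | Γ (n + 1) ω = J} fun _ => (1 : ℝ)) Q :=
      (integrable_const 1).indicator (hset _ _)
    have h1 := setIntegral_condExp (μ := Q) (hm n) hint hB
    rw [setIntegral_congr_ae (g := fun _ => γ K J) (hm n _ hB)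
      (by filter_upwards [hMarkov n J] with ω hω hωB
          rw [hω]; rw [hωB.2])] at h1
    rw [setIntegral_indicator (hset _ _)] at h1
    simp only [setIntegral_const, smul_eq_mul, mul_one] at h1
    exact h1.symm
  have hbd : ∀ n, ∀ᵐ ω ∂Q, ‖D n ω‖ ≤ h := by
    intro n
    have key : ∀ K J, K ≠ J → ¬ 0 < q K J → ∀ᵐ ω ∂Q, ¬ (Γ n ω = K ∧ Γ (n + 1) ω = J) := by
      intro K J hKJ hq
      have hq0 : q K J = 0 := le_antisymm (not_lt.1 hq) (hq_nonneg K J hKJ.symm)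
      have h1 := hjoint n Set.univ MeasurableSet.univ K J
      rw [hγ_off K J hKJ.symm, hq0, mul_zero, mul_zero, Set.univ_inter,
        measureReal_eq_zero_iff] at h1
      rw [ae_iff]
      simpa [Set.inter_def] using h1
    have key2 : ∀ᵐ ω ∂Q, ∀ K J, K ≠ J → ¬ 0 < q K J → ¬ (Γ n ω = K ∧ Γ (n + 1) ω = J) := by
      rw [ae_all_iff]; intro K
      rw [ae_all_iff]; intro J
      by_cases h1 : K ≠ J
      · by_cases h2 : ¬ 0 < q K J
        · filter_upwards [key K J h1 h2] with ω hω _ _ using hω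
        · exact Filter.Eventually.of_forall fun ω _ h3 => absurd h3 h2
      · exact Filter.Eventually.of_forall fun ω h3 => absurd h3 h1
    filter_upwards [key2] with ω hω
    by_cases h1 : Γ (n + 1) ω = Γ n ω
    · simp [D, g, h1, hh.le]
    · have h2 : 0 < q (Γ n ω) (Γ (n + 1) ω) := by
        by_contra h3
        exact hω _ _ (Ne.symm h1) h3 ⟨rfl, rfl⟩
      simpa [D, g, h1] using hclose _ _ (Ne.symm h1) h2
  have hDint : ∀ n, Integrable (D n) Q := fun n =>
    Integrable.of_bound (hD n).aestronglyMeasurable h (hbd n)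
  have hΞint : ∀ n, Integrable (Ξ n) Q := by
    intro n
    rw [hΞ' n]
    exact integrable_finsetSum _ fun i _ => hDint i
  have hfib : ∀ n (A : Set Ω), MeasurableSet A → 
      HasSum (fun J => ∫ ω in A ∩ {ω | Γ n ω = J}, (D n ω) ∂Q) (∫ ω in A, D n ω ∂Q) ∧
      HasSum (fun J => ∫ ω in A ∩ {ω | Γ (n + 1) ω = J}, (D n ω) ∂Q) (∫ ω in A, D n ω ∂Q) := by
    intro n A hA
    have aux : ∀ k, HasSum (fun J => ∫ ω in A ∩ {ω | Γ k ω = J}, (D n ω) ∂Q)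
        (∫ ω in A, D n ω ∂Q) := by
      intro k
      have h1 := hasSum_integral_iUnion (μ := Q) (f := D n)
        (s := fun J => A ∩ {ω | Γ k ω = J}) (fun J => hA.inter (hset k J))
        (by
          intro J J' hJ
          refine Set.disjoint_left.2 ?_
          rintro ω ⟨_, h1⟩ ⟨_, h2⟩
          exact hJ (h1.symm.trans h2))
        (hDint n).integrableOn
      have h2 : (⋃ J, A ∩ {ω | Γ k ω = J}) = A := by
        ext ω; simp
      rwa [h2] at h1
    exact ⟨aux n, aux (n + 1)⟩
  have hzero : ∀ n (A : Set Ω), MeasurableSet[m n] A → ∫ ω in A, D n ω ∂Q = 0 := by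
    intro n A hA
    rw [← (hfib n A (hm n A hA)).1.tsum_eq]
    refine (tsum_congr fun K => ?_).trans tsum_zero
    have hBm : MeasurableSet (A ∩ {ω | Γ n ω = K}) := (hm n A hA).inter (hset n K)
    rw [← (hfib n _ hBm).2.tsum_eq]
    have h1 : ∀ J, ∫ ω in (A ∩ {ω | Γ n ω = K}) ∩ {ω | Γ (n + 1) ω = J}, (D n ω) ∂Q
        = (Q.real (A ∩ {ω | Γ n ω = K}) * (1 + δ K * Δt)⁻¹) •
          (if J = K then 0 else q K J • (e K - xf K J)) := by
      intro J
      rw [setIntegral_congr_fun (g := fun _ => g K J) (hBm.inter (hset _ J))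
        (by rintro ω ⟨⟨_, h1⟩, h2⟩
            simp only [Set.mem_setOf_eq] at h1 h2
            simp only [D, h1, h2])]
      rw [setIntegral_const, hjoint n A hA K J]
      by_cases hJ : J = K
      · simp [g, hJ]
      · simp only [g, hJ, if_false, hγ_off K J hJ, smul_smul, mul_assoc]
    rw [tsum_congr h1, tsum_const_smul'', hbar K, smul_zero]
  refine ⟨hΞm, hΞint, fun n => ?_⟩
  symm
  refine ae_eq_condExp_of_forall_setIntegral_eq (hm n) (hΞint (n + 1))
    (fun s _ _ => (hΞint n).integrableOn) ?_ (hΞm n).stronglyMeasurable.aestronglyMeasurable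
  intro A hA _
  have h1 : ∀ ω, Ξ (n + 1) ω = Ξ n ω + D n ω := by
    intro ω
    rw [hΞ' (n + 1), hΞ' n]
    exact Finset.sum_range_succ _ _
  simp only [h1]
  rw [integral_add (hΞint n).integrableOn (hDint n).integrableOn, hzero n A hA, add_zero]
end

section
/- Let (Ω, 𝒜, P) be a probability space and d ≥ 1. There exists a constant c > 0, depending only on d, such that for any ℝ^d-valued martingale (Y_n)_{n≥0} with respect to a filtration (ℋ_n)_{n≥0} satisfying Y_0 = 0 and, for all n ≥ 0, |Y_{n+1} − Y_n| ≤ 1 almost surely and E[|Y_{n+1} − Y_n|² | ℋ_n] ≤ v almost surely for a deterministic real v > 0, the following holds for all n ≥ 0 and all u > 0: P(sup_{0≤k≤n} |Y_k| ≥ u) ≤ c [exp(−u²/(c n v)) + exp(−u/c)]. -/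
open MeasureTheory

theorem mart_comp {Ω : Type} [m0 : MeasurableSpace Ω] {P : Measure Ω} [IsProbabilityMeasure P]
    {ℋ : Filtration ℕ m0} {E : Type} [NormedAddCommGroup E] [NormedSpace ℝ E] [CompleteSpace E]
    {Y : ℕ → Ω → E} (hY : Martingale Y ℋ P) (L : E →L[ℝ] ℝ) :
    Martingale (fun n ω => L (Y n ω)) ℋ P := by
  refine ⟨fun n => L.continuous.comp_stronglyMeasurable (hY.1 n), fun i j hij => ?_⟩
  have h1 := L.comp_condExp_comm (m := ℋ i) (hY.integrable j)
  filter_upwards [h1, hY.2 i j hij] with ω h1 h2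
  have : P[(fun ω => L (Y j ω)) | ℋ i] ω = L ((P[Y j | ℋ i]) ω) := by
    exact h1.symm
  rw [this, h2]

section scalar
variable {Ω : Type} [m0 : MeasurableSpace Ω] {P : Measure Ω} [IsProbabilityMeasure P]
    {ℋ : Filtration ℕ m0} {X : ℕ → Ω → ℝ}

theorem bdd_X (h0 : ∀ᵐ ω ∂P, X 0 ω = 0)
    (hj : ∀ n : ℕ, ∀ᵐ ω ∂P, |X (n + 1) ω - X n ω| ≤ 1) (n : ℕ) :
    ∀ᵐ ω ∂P, |X n ω| ≤ n := by
  induction n with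
  | zero => filter_upwards [h0] with ω h; simp [h]
  | succ k ih =>
    filter_upwards [ih, hj k] with ω h1 h2
    rw [abs_le] at *
    push_cast
    constructor <;> linarith [h1.1, h1.2, h2.1, h2.2]

theorem int_Z (hX : Martingale X ℋ P) (h0 : ∀ᵐ ω ∂P, X 0 ω = 0)
    (hj : ∀ n : ℕ, ∀ᵐ ω ∂P, |X (n + 1) ω - X n ω| ≤ 1) (l : ℝ) (hl : 0 ≤ l) (n : ℕ) :
    Integrable (fun ω => Real.exp (l * X n ω)) P := by
  refine Integrable.of_bound (C := Real.exp (l * n)) ?_ ?_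
  · have := ((hX.1 n).mono (ℋ.le n)).measurable
    exact (by fun_prop : Measurable fun ω => Real.exp (l * X n ω)).aestronglyMeasurable
  · filter_upwards [bdd_X h0 hj n] with ω h
    rw [Real.norm_eq_abs, abs_of_pos (Real.exp_pos _)]
    gcongr
    exact (abs_le.1 h).2

theorem sub_Z (hX : Martingale X ℋ P) (h0 : ∀ᵐ ω ∂P, X 0 ω = 0)
    (hj : ∀ n : ℕ, ∀ᵐ ω ∂P, |X (n + 1) ω - X n ω| ≤ 1) (l : ℝ) (hl : 0 ≤ l) :
    Submartingale (fun n ω => Real.exp (l * X n ω)) ℋ P := by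
  refine submartingale_nat (fun n => ?_) (int_Z hX h0 hj l hl) fun i => ?_
  · exact (by fun_prop : Continuous fun x : ℝ => Real.exp (l * x)).comp_stronglyMeasurable (hX.1 n)
  · have hc : ConvexOn ℝ Set.univ (fun x : ℝ => Real.exp (l * x)) := by
      have := convexOn_exp.comp_linearMap (LinearMap.lsmul ℝ ℝ l)
      simpa [Function.comp_def] using this
    have := hc.map_condExp_le_univ (ℋ.le i) (μ := P)
      (by fun_prop : Continuous fun x : ℝ => Real.exp (l * x)).lowerSemicontinuous
      (hX.integrable (i+1)) (int_Z hX h0 hj l hl (i+1))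
    filter_upwards [this, hX.2 i (i+1) (by omega)] with ω h1 h2
    rw [Function.comp_apply, h2] at h1
    exact h1

theorem step_Z (hX : Martingale X ℋ P) (h0 : ∀ᵐ ω ∂P, X 0 ω = 0)
    (hj : ∀ n : ℕ, ∀ᵐ ω ∂P, |X (n + 1) ω - X n ω| ≤ 1) (v : ℝ)
    (hv : ∀ n : ℕ, ∀ᵐ ω ∂P, (P[(fun ω' => (X (n + 1) ω' - X n ω') ^ 2) | ℋ n]) ω ≤ v)
    (l : ℝ) (hl : 0 ≤ l) (hl1 : l ≤ 1) (n : ℕ) :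
    ∫ ω, Real.exp (l * X (n+1) ω) ∂P ≤ (1 + l ^ 2 * v) * ∫ ω, Real.exp (l * X n ω) ∂P := by
  have hm0 := ((hX.1 n).mono (ℋ.le n)).measurable
  have hm1 := ((hX.1 (n+1)).mono (ℋ.le (n+1))).measurable
  set D : Ω → ℝ := fun ω => X (n + 1) ω - X n ω with hD
  set D2 : Ω → ℝ := fun ω => (X (n + 1) ω - X n ω) ^ 2 with hD2
  set Z : Ω → ℝ := fun ω => Real.exp (l * X n ω) with hZ
  have iD : Integrable D P := (hX.integrable _).sub (hX.integrable _)
  have iD2 : Integrable D2 P := by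
    refine Integrable.of_bound (C := 1)
      (by fun_prop : Measurable D2).aestronglyMeasurable ?_
    filter_upwards [hj n] with ω h
    simp only [hD2, Real.norm_eq_abs, abs_pow]
    exact pow_le_one₀ (abs_nonneg _) h
  set W : Ω → ℝ := ((fun _ => (1:ℝ)) + l • D) + (l ^ 2) • D2 with hW
  have iW : Integrable W P :=
    ((integrable_const _).add (iD.smul l)).add (iD2.smul (l ^ 2))
  have iZ : Integrable Z P := int_Z hX h0 hj l hl n
  have bW : ∀ᵐ ω ∂P, ‖W ω‖ ≤ 3 := by
    filter_upwards [hj n] with ω h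
    simp only [hW, hD, hD2, Pi.add_apply, Pi.smul_apply, smul_eq_mul, Real.norm_eq_abs]
    have h2 : (X (n + 1) ω - X n ω)^2 ≤ 1 := by rw [← sq_abs]; exact pow_le_one₀ (abs_nonneg _) h
    have h3 : |l * (X (n + 1) ω - X n ω)| ≤ 1 := by
      rw [abs_mul, abs_of_nonneg hl]; exact mul_le_one₀ hl1 (abs_nonneg _) h
    have h4 : l ^ 2 * (X (n + 1) ω - X n ω)^2 ≤ 1 :=
      mul_le_one₀ (pow_le_one₀ hl hl1) (sq_nonneg _) h2
    have h5 : 0 ≤ l ^ 2 * (X (n + 1) ω - X n ω)^2 := by positivity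
    rw [abs_le] at *
    constructor <;> linarith [h3.1, h3.2]
  have iZW : Integrable (Z * W) P := by
    have := iZ.bdd_mul (c := 3) iW.1 bW
    rw [mul_comm]
    exact this
  have cW : P[W | ℋ n] ≤ᵐ[P] fun _ => 1 + l ^ 2 * v := by
    have e1 := condExp_add (m := ℋ n) ((integrable_const (1:ℝ)).add (iD.smul l)) (iD2.smul (l ^ 2))
    have e2 := condExp_add (m := ℋ n) (integrable_const (μ := P) (1:ℝ)) (iD.smul l)
    have e3 := condExp_smul (μ := P) l D (ℋ n)
    have e4 := condExp_smul (μ := P) (l^2) D2 (ℋ n)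
    have e5 := condExp_sub (m := ℋ n) (hX.integrable (n+1)) (hX.integrable n)
    have e6 := hX.2 n (n+1) (by omega)
    have e7 := hX.2 n n le_rfl
    have e8 := condExp_const (μ := P) (ℋ.le n) (1:ℝ)
    filter_upwards [e1, e2, e3, e4, e5, e6, e7, hv n] with ω e1 e2 e3 e4 e5 e6 e7 hv
    have e5' : P[D | ℋ n] ω = 0 := by
      have : P[D | ℋ n] ω = P[X (n+1) - X n | ℋ n] ω := rfl
      rw [this, e5, Pi.sub_apply, e6, e7, sub_self]
    rw [hW, e1, Pi.add_apply, e2, Pi.add_apply, e3, e4, e8]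
    simp only [Pi.smul_apply, smul_eq_mul, e5']
    have : l ^ 2 * P[D2 | ℋ n] ω ≤ l ^ 2 * v := by gcongr
    linarith
  have pull := condExp_mul_of_stronglyMeasurable_left (μ := P) (m := ℋ n) (f := Z) (g := W)
    ((by fun_prop : Continuous fun x : ℝ => Real.exp (l * x)).comp_stronglyMeasurable (hX.1 n))
    iZW iW
  calc ∫ ω, Real.exp (l * X (n+1) ω) ∂P ≤ ∫ ω, (Z * W) ω ∂P := by
        refine integral_mono_ae (int_Z hX h0 hj l hl (n+1)) iZW ?_
        filter_upwards [hj n] with ω h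
        have h3 : |l * (X (n + 1) ω - X n ω)| ≤ 1 := by
          rw [abs_mul, abs_of_nonneg hl]; exact mul_le_one₀ hl1 (abs_nonneg _) h
        have h4 := (abs_le.1 (Real.abs_exp_sub_one_sub_id_le h3)).2
        have h5 : l * X (n+1) ω = l * X n ω + l * (X (n + 1) ω - X n ω) := by ring
        simp only [h5, Real.exp_add, Pi.mul_apply, hZ]
        gcongr
        simp only [hW, hD, hD2, Pi.add_apply, Pi.smul_apply, smul_eq_mul]
        nlinarith
    _ = ∫ ω, (P[Z * W | ℋ n]) ω ∂P := (integral_condExp (ℋ.le n)).symm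
    _ ≤ ∫ ω, (1 + l ^ 2 * v) * Z ω ∂P := by
        refine integral_mono_ae integrable_condExp (iZ.const_mul _) ?_
        filter_upwards [pull, cW] with ω h1 h2
        rw [h1, Pi.mul_apply, mul_comm]
        gcongr
    _ = _ := by rw [integral_const_mul]

theorem mgf_Z (hX : Martingale X ℋ P) (h0 : ∀ᵐ ω ∂P, X 0 ω = 0)
    (hj : ∀ n : ℕ, ∀ᵐ ω ∂P, |X (n + 1) ω - X n ω| ≤ 1) (v : ℝ)
    (hv : ∀ n : ℕ, ∀ᵐ ω ∂P, (P[(fun ω' => (X (n + 1) ω' - X n ω') ^ 2) | ℋ n]) ω ≤ v)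
    (l : ℝ) (hl : 0 ≤ l) (hl1 : l ≤ 1) (n : ℕ) :
    ∫ ω, Real.exp (l * X n ω) ∂P ≤ Real.exp (n * (l ^ 2 * v)) := by
  induction n with
  | zero =>
    have : ∫ ω, Real.exp (l * X 0 ω) ∂P = ∫ ω, (1:ℝ) ∂P := by
      refine integral_congr_ae ?_
      filter_upwards [h0] with ω h
      simp [h]
    rw [this]; simp
  | succ k ih =>
    refine (step_Z hX h0 hj v hv l hl hl1 k).trans ?_
    have h1 : 1 + l ^ 2 * v ≤ Real.exp (l ^ 2 * v) := by
      linarith [Real.add_one_le_exp (l ^ 2 * v)]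
    have h2 : 0 ≤ ∫ ω, Real.exp (l * X k ω) ∂P := integral_nonneg fun _ => (Real.exp_pos _).le
    calc _ ≤ Real.exp (l ^ 2 * v) * Real.exp (k * (l ^ 2 * v)) := by gcongr
      _ = _ := by rw [← Real.exp_add]; congr 1; push_cast; ring

theorem tail_Z (hX : Martingale X ℋ P) (h0 : ∀ᵐ ω ∂P, X 0 ω = 0)
    (hj : ∀ n : ℕ, ∀ᵐ ω ∂P, |X (n + 1) ω - X n ω| ≤ 1) (v : ℝ)
    (hv : ∀ n : ℕ, ∀ᵐ ω ∂P, (P[(fun ω' => (X (n + 1) ω' - X n ω') ^ 2) | ℋ n]) ω ≤ v)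
    (l : ℝ) (hl : 0 ≤ l) (hl1 : l ≤ 1) (n : ℕ) (a : ℝ) :
    P.real {ω | ∃ k ≤ n, a ≤ X k ω} ≤ Real.exp (n * (l ^ 2 * v) - l * a) := by
  have hd := maximal_ineq (sub_Z hX h0 hj l hl) (fun _ _ => (Real.exp_pos _).le)
    (ε := ⟨Real.exp (l * a), (Real.exp_pos _).le⟩) n
  set S := {ω | (((⟨Real.exp (l * a), (Real.exp_pos _).le⟩ : NNReal)) : ℝ) ≤
    (Finset.range (n + 1)).sup' Finset.nonempty_range_add_one fun k => Real.exp (l * X k ω)} with hS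
  have hsub : {ω | ∃ k ≤ n, a ≤ X k ω} ⊆ S := by
    rintro ω ⟨k, hk, hak⟩
    simp only [hS, Set.mem_ofPred_eq, Finset.le_sup'_iff]
    exact ⟨k, by simp; omega, Real.exp_le_exp.2 (mul_le_mul_of_nonneg_left hak hl)⟩
  have h1 : Real.exp (l * a) * P.real S ≤ ∫ ω in S, Real.exp (l * X n ω) ∂P := by
    have := ENNReal.toReal_mono ENNReal.ofReal_ne_top hd
    rw [ENNReal.toReal_mul, ENNReal.toReal_ofReal
      (integral_nonneg fun _ => (Real.exp_pos _).le)] at this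
    exact this
  have h2 : ∫ ω in S, Real.exp (l * X n ω) ∂P ≤ ∫ ω, Real.exp (l * X n ω) ∂P :=
    setIntegral_le_integral (int_Z hX h0 hj l hl n) (ae_of_all _ fun _ => (Real.exp_pos _).le)
  have h3 := mgf_Z hX h0 hj v hv l hl hl1 n
  have h4 : P.real {ω | ∃ k ≤ n, a ≤ X k ω} ≤ P.real S := measureReal_mono hsub
  rw [Real.exp_sub, le_div_iff₀ (Real.exp_pos _)]
  nlinarith [Real.exp_pos (l * a)]

theorem tail_final (hX : Martingale X ℋ P) (h0 : ∀ᵐ ω ∂P, X 0 ω = 0)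
    (hj : ∀ n : ℕ, ∀ᵐ ω ∂P, |X (n + 1) ω - X n ω| ≤ 1) (v : ℝ) (hv0 : 0 < v)
    (hv : ∀ n : ℕ, ∀ᵐ ω ∂P, (P[(fun ω' => (X (n + 1) ω' - X n ω') ^ 2) | ℋ n]) ω ≤ v)
    (n : ℕ) (a : ℝ) (ha : 0 < a) :
    P.real {ω | ∃ k ≤ n, a ≤ X k ω} ≤ Real.exp (-a ^ 2 / (4 * n * v)) + Real.exp (-a / 2) := by
  by_cases h : a ≤ 2 * n * v
  · have hnv : 0 < n * v := by nlinarith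
    refine (tail_Z hX h0 hj v hv (a / (2 * (n * v))) (by positivity) ?_ n a).trans ?_
    · rw [div_le_one (by positivity)]; linarith
    · have : n * ((a / (2 * (n * v))) ^ 2 * v) - a / (2 * (n * v)) * a = -a ^ 2 / (4 * n * v) := by
        have hn : (n:ℝ) ≠ 0 := by rintro h; simp [h] at hnv
        field_simp
        ring
      rw [this]
      linarith [Real.exp_pos (-a / 2)]
  · refine (tail_Z hX h0 hj v hv 1 (by norm_num) le_rfl n a).trans ?_
    have : Real.exp (n * (1 ^ 2 * v) - 1 * a) ≤ Real.exp (-a / 2) := by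
      apply Real.exp_le_exp.2; push Not at h; linarith
    linarith [Real.exp_pos (-a ^ 2 / (4 * n * v))]
end scalar

theorem tail_dir {Ω : Type} [m0 : MeasurableSpace Ω] {P : Measure Ω} [IsProbabilityMeasure P]
    {ℋ : Filtration ℕ m0} {E : Type} [NormedAddCommGroup E] [NormedSpace ℝ E] [CompleteSpace E]
    {Y : ℕ → Ω → E} (hY : Martingale Y ℋ P) (h0 : ∀ᵐ ω ∂P, Y 0 ω = 0)
    (v : ℝ) (hv0 : 0 < v) (hj : ∀ n : ℕ, ∀ᵐ ω ∂P, ‖Y (n + 1) ω - Y n ω‖ ≤ 1)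
    (hv : ∀ n : ℕ, ∀ᵐ ω ∂P, (P[(fun ω' => ‖Y (n + 1) ω' - Y n ω'‖ ^ 2) | ℋ n]) ω ≤ v)
    (L : E →L[ℝ] ℝ) (hL : ∀ x, |L x| ≤ ‖x‖) (n : ℕ) (a : ℝ) (ha : 0 < a) :
    P.real {ω | ∃ k ≤ n, a ≤ L (Y k ω)} ≤
      Real.exp (-a ^ 2 / (4 * n * v)) + Real.exp (-a / 2) := by
  have hX := mart_comp hY L
  refine tail_final hX ?_ ?_ v hv0 ?_ n a ha
  · filter_upwards [h0] with ω h; simp [h]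
  · intro n
    filter_upwards [hj n] with ω h
    rw [← map_sub]
    exact (hL _).trans h
  · intro n
    have i1 : Integrable (fun ω' => ‖Y (n + 1) ω' - Y n ω'‖ ^ 2) P := by
      refine Integrable.of_bound (C := 1)
        ((((hY.integrable _).1.sub (hY.integrable _).1).norm).pow 2) ?_
      filter_upwards [hj n] with ω h
      rw [norm_pow, norm_norm]
      exact pow_le_one₀ (norm_nonneg _) h
    have hle : ∀ ω, (L (Y (n+1) ω) - L (Y n ω)) ^ 2 ≤ ‖Y (n + 1) ω - Y n ω‖ ^ 2 := by
      intro ω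
      rw [← map_sub, ← sq_abs]
      gcongr
      exact hL _
    have i2 : Integrable (fun ω => (L (Y (n+1) ω) - L (Y n ω)) ^ 2) P := by
      refine i1.mono' ((((hX.integrable _).1.sub (hX.integrable _).1)).pow 2)
        (ae_of_all _ fun ω => ?_)
      rw [Real.norm_eq_abs, abs_of_nonneg (sq_nonneg _)]
      exact hle ω
    filter_upwards [condExp_mono (m := ℋ n) i2 i1 (ae_of_all _ hle), hv n] with ω h1 h2
    exact h1.trans h2



/-- **Freedman-type concentration inequality for vector-valued martingales.**
For every `d ≥ 1` there is a constant `c > 0`, depending only on `d`, such that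
for any `ℝ^d`-valued martingale `(Y n)` with respect to a filtration `(ℋ n)`
on a probability space, with `Y 0 = 0`, jumps `|Y (n+1) − Y n| ≤ 1` a.s. and
conditional increment variance `E[|Y (n+1) − Y n|² | ℋ n] ≤ v` a.s. for a
deterministic `v > 0`, one has, for all `n` and all `u > 0`,
`P(sup_{k ≤ n} |Y k| ≥ u) ≤ c (e^{−u²/(c n v)} + e^{−u/c})`. -/
theorem stmt_13 (d : ℕ) (hd : 1 ≤ d) :
    ∃ c : ℝ, 0 < c ∧
      ∀ (Ω : Type) [m0 : MeasurableSpace Ω] (P : Measure Ω),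
        IsProbabilityMeasure P →
        ∀ (ℋ : Filtration ℕ m0) (Y : ℕ → Ω → EuclideanSpace ℝ (Fin d)),
          Martingale Y ℋ P →
          (∀ᵐ ω ∂P, Y 0 ω = 0) →
          ∀ v : ℝ, 0 < v →
          (∀ n : ℕ, ∀ᵐ ω ∂P, ‖Y (n + 1) ω - Y n ω‖ ≤ 1) →
          (∀ n : ℕ, ∀ᵐ ω ∂P,
            (P[(fun ω' => ‖Y (n + 1) ω' - Y n ω'‖ ^ 2) | ℋ n]) ω ≤ v) →
          ∀ n : ℕ, ∀ u : ℝ, 0 < u →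
            (P {ω | ∃ k ≤ n, u ≤ ‖Y k ω‖}).toReal ≤
              c * (Real.exp (-u ^ 2 / (c * n * v)) + Real.exp (-u / c)) := by
  have hd0 : (0:ℝ) < d := by exact_mod_cast hd
  have hd1 : (1:ℝ) ≤ d := by exact_mod_cast hd
  have hd2 : (d:ℝ) * 2 ≤ 4 * (d:ℝ) ^ 2 := by nlinarith
  refine ⟨4 * d ^ 2, by positivity, ?_⟩
  intro Ω m0 P hP ℋ Y hY h0 v hv0 hj hv n u hu
  let L : Fin d × Bool → (EuclideanSpace ℝ (Fin d) →L[ℝ] ℝ) := fun p =>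
    if p.2 then EuclideanSpace.proj p.1 else -EuclideanSpace.proj p.1
  have hL : ∀ p x, |L p x| ≤ ‖x‖ := by
    rintro ⟨i, b⟩ x
    have := PiLp.norm_apply_le x i
    rw [Real.norm_eq_abs] at this
    cases b <;> simpa [L] using this
  have ha : 0 < u / d := by positivity
  have hsub : {ω | ∃ k ≤ n, u ≤ ‖Y k ω‖} ⊆ ⋃ p, {ω | ∃ k ≤ n, u / d ≤ L p (Y k ω)} := by
    rintro ω ⟨k, hk, h⟩
    rw [Set.mem_iUnion]
    by_contra hcon
    simp only [Set.mem_ofPred_eq, not_exists, not_and, not_le] at hcon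
    have hlt : ∀ i, |Y k ω i| < u / d := by
      intro i
      have h1 := hcon (i, true) k hk
      have h2 := hcon (i, false) k hk
      simp [L] at h1 h2
      rw [abs_lt]
      constructor <;> linarith
    have hsq : ‖Y k ω‖ ^ 2 < u ^ 2 := by
      rw [EuclideanSpace.norm_sq_eq]
      calc ∑ i, ‖Y k ω i‖ ^ 2 < ∑ i : Fin d, (u / d) ^ 2 := by
            refine Finset.sum_lt_sum_of_nonempty ⟨⟨0, hd⟩, Finset.mem_univ _⟩ fun i _ => ?_
            rw [Real.norm_eq_abs]
            exact pow_lt_pow_left₀ (hlt i) (abs_nonneg _) (by norm_num)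
        _ = u ^ 2 / d := by simp; field_simp
        _ ≤ u ^ 2 := div_le_self (by positivity) hd1
    have : u ^ 2 ≤ ‖Y k ω‖ ^ 2 := by gcongr
    linarith
  have hb := fun p => tail_dir hY h0 v hv0 hj hv (L p) (hL p) n (u / d) ha
  have e1 : -(u / d) ^ 2 / (4 * n * v) = -u ^ 2 / (4 * d ^ 2 * n * v) := by
    rw [div_pow, ← neg_div, div_div]; congr 1; ring
  have e2 : Real.exp (-(u / d) / 2) ≤ Real.exp (-u / (4 * d ^ 2)) := by
    apply Real.exp_le_exp.2
    rw [← neg_div, div_div, neg_div, neg_div, neg_le_neg_iff]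
    exact div_le_div_of_nonneg_left hu.le (by positivity) hd2
  set A := Real.exp (-u ^ 2 / (4 * d ^ 2 * n * v))
  set B := Real.exp (-u / (4 * d ^ 2))
  have hA : 0 < A := Real.exp_pos _
  have hB : 0 < B := Real.exp_pos _
  calc (P {ω | ∃ k ≤ n, u ≤ ‖Y k ω‖}).toReal
      ≤ P.real (⋃ p, {ω | ∃ k ≤ n, u / d ≤ L p (Y k ω)}) := measureReal_mono hsub
    _ ≤ ∑ p, P.real {ω | ∃ k ≤ n, u / d ≤ L p (Y k ω)} := measureReal_iUnion_fintype_le _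
    _ ≤ ∑ p : Fin d × Bool, (A + B) := by
        refine Finset.sum_le_sum fun p _ => (hb p).trans ?_
        rw [e1]
        gcongr
    _ = (d * 2) * (A + B) := by simp; ring
    _ ≤ 4 * d ^ 2 * (A + B) := mul_le_mul_of_nonneg_right hd2 (by positivity)
end
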